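/- Let n ≥ 2 and consider the open domain of points v = (v_1,…,v_n) ∈ ℝⁿ with v_k > 0 for k = 2,…,n and σ(v) := Σ_{k=2}^n v_k² < 4. Define F(v) = v_1³/6 + ½·v_1·σ − Σ_{k=2}^n v_k²·log v_k − (1/3)·(2 + σ)·√(4 − σ) + σ·log(2 + √(4 − σ)). Then: (i) ∂³F/∂v_α∂v_β∂v_1 = δ_αβ for all α, β; and (ii) F satisfies the WDVV associativity equations with η equal to the identity matrix, i.e. Σ_{λ=1}^n (∂³F/∂v_α∂v_β∂v_λ)·(∂³F/∂v_λ∂v_γ∂v_δ) = Σ_{λ=1}^n (∂³F/∂v_δ∂v_β∂v_λ)·(∂³F/∂v_λ∂v_γ∂v_α) for all indices α, β, γ, δ. -/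

import Mathlib

/-- `σ(v) = ∑_{k ≥ 2} v_k²` (the index `0` plays the role of the distinguished
coordinate `v¹`; the dimension is `n + 2 ≥ 2`). -/
noncomputable def wdvvSigma {n : ℕ} (v : Fin (n + 2) → ℝ) : ℝ :=
  ∑ k ∈ Finset.univ.erase 0, (v k) ^ 2

/-- The linearly degenerate WDVV potential
`F = v₁³/6 + ½ v₁ σ - ∑_{k≥2} v_k² log v_k - ⅓(2+σ)√(4-σ) + σ log(2+√(4-σ))`. -/
noncomputable def wdvvF {n : ℕ} (v : Fin (n + 2) → ℝ) : ℝ :=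
  v 0 ^ 3 / 6 + 1 / 2 * v 0 * wdvvSigma v
    - ∑ k ∈ Finset.univ.erase 0, (v k) ^ 2 * Real.log (v k)
    - 1 / 3 * (2 + wdvvSigma v) * Real.sqrt (4 - wdvvSigma v)
    + wdvvSigma v * Real.log (2 + Real.sqrt (4 - wdvvSigma v))

/-- The third partial derivative `∂³F/∂v_α ∂v_β ∂v_γ`. -/
noncomputable def wdvvF3 {n : ℕ} (v : Fin (n + 2) → ℝ) (α β γ : Fin (n + 2)) : ℝ :=
  iteratedFDeriv ℝ 3 wdvvF v ![Pi.single α 1, Pi.single β 1, Pi.single γ 1]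


/-- The open domain. -/
def wdvvU (n : ℕ) : Set (Fin (n + 2) → ℝ) :=
  {v | (∀ k : Fin (n + 2), k ≠ 0 → 0 < v k) ∧ wdvvSigma v < 4}

noncomputable def wdvvS {n : ℕ} (v : Fin (n + 2) → ℝ) : ℝ := Real.sqrt (4 - wdvvSigma v)

noncomputable def wdvvL {n : ℕ} (v : Fin (n + 2) → ℝ) : ℝ :=
  - wdvvS v + 2 * Real.log (2 + wdvvS v)

lemma wdvvSigma_contDiff {n : ℕ} : ContDiff ℝ 3 (wdvvSigma (n := n)) := by
  unfold wdvvSigma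
  fun_prop

lemma wdvvU_open {n : ℕ} : IsOpen (wdvvU n) := by
  have e : wdvvU n = (⋂ k : Fin (n + 2), ⋂ _ : k ≠ 0, {v | 0 < v k}) ∩ {v | wdvvSigma v < 4} := by
    ext v
    simp [wdvvU]
  rw [e]
  apply IsOpen.inter
  · refine isOpen_iInter_of_finite fun k => isOpen_iInter_of_finite fun hk => ?_
    exact isOpen_lt continuous_const (continuous_apply k)
  · exact isOpen_lt wdvvSigma_contDiff.continuous continuous_const

lemma wdvvS_pos {n : ℕ} {x : Fin (n + 2) → ℝ} (hx : x ∈ wdvvU n) : 0 < wdvvS x :=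
  Real.sqrt_pos.2 (by linarith [hx.2])

lemma wdvvS_sq {n : ℕ} {x : Fin (n + 2) → ℝ} (hx : x ∈ wdvvU n) :
    wdvvS x ^ 2 = 4 - wdvvSigma x :=
  Real.sq_sqrt (by linarith [hx.2])

lemma wdvvF_contDiffAt {n : ℕ} {x : Fin (n + 2) → ℝ} (hx : x ∈ wdvvU n) :
    ContDiffAt ℝ 3 wdvvF x := by
  have h1 : ContDiffAt ℝ 3 (wdvvSigma (n := n)) x := wdvvSigma_contDiff.contDiffAt
  have h2 : ContDiffAt ℝ 3 (fun x : Fin (n + 2) → ℝ => Real.sqrt (4 - wdvvSigma x)) x :=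
    (contDiffAt_const.sub h1).sqrt (by linarith [hx.2])
  have h3 : ContDiffAt ℝ 3 (fun x : Fin (n + 2) → ℝ =>
      Real.log (2 + Real.sqrt (4 - wdvvSigma x))) x :=
    (contDiffAt_const.add h2).log (by positivity)
  have h4 : ContDiffAt ℝ 3 (fun x : Fin (n + 2) → ℝ =>
      ∑ k ∈ Finset.univ.erase 0, (x k) ^ 2 * Real.log (x k)) x := by
    apply ContDiffAt.sum
    intro k hk
    have := hx.1 k (Finset.ne_of_mem_erase hk)
    have h5 : ContDiffAt ℝ 3 (fun x : Fin (n + 2) → ℝ => x k) x := by fun_prop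
    exact (h5.pow 2).mul (h5.log this.ne')
  have h0 : ContDiffAt ℝ 3 (fun x : Fin (n + 2) → ℝ => x 0) x := by fun_prop
  unfold wdvvF
  exact (((((h0.pow 3).div_const 6).add ((contDiffAt_const.mul h0).mul h1)).sub h4).sub
    ((contDiffAt_const.mul (contDiffAt_const.add h1)).mul h2)).add (h1.mul h3)

lemma iter_step {E : Type*} [NormedAddCommGroup E] [NormedSpace ℝ E] {f g : E → ℝ} {x : E}
    {k : ℕ} (hf : ContDiffAt ℝ (k + 1 : ℕ) f x) (m : Fin (k + 1) → E) (d : ℝ)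
    (hg : (fun y => iteratedFDeriv ℝ k f y (Fin.tail m)) =ᶠ[nhds x] g)
    (hd : HasLineDerivAt ℝ g d x (m 0)) : iteratedFDeriv ℝ (k + 1) f x m = d := by
  have h1 : DifferentiableAt ℝ (iteratedFDeriv ℝ k f) x :=
    hf.differentiableAt_iteratedFDeriv (by exact_mod_cast Nat.lt_succ_self k)
  rw [iteratedFDeriv_succ_apply_left,
    ← fderiv_continuousMultilinear_apply_const_apply h1, hg.fderiv_eq]
  have h2 : DifferentiableAt ℝ g x := hg.differentiableAt_iff.1
    (h1.continuousMultilinear_apply_const _)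
  rw [← h2.lineDeriv_eq_fderiv]
  exact hd.lineDeriv

section
variable {n : ℕ} {x : Fin (n + 2) → ℝ} (a : Fin (n + 2))

lemma ld_coord (k : Fin (n + 2)) :
    HasLineDerivAt ℝ (fun x : Fin (n + 2) → ℝ => x k) (if a = k then 1 else 0) x
      (Pi.single a 1) := by
  unfold HasLineDerivAt
  have : HasDerivAt (fun t : ℝ => x k + t * (if a = k then 1 else 0))
      (1 * (if a = k then 1 else 0)) 0 :=
    ((hasDerivAt_id (0:ℝ)).mul_const _).const_add _
  simpa [Pi.single_apply, eq_comm] using this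

lemma ld_sigma :
    HasLineDerivAt ℝ wdvvSigma (if a = 0 then 0 else 2 * x a) x (Pi.single a 1) := by
  unfold HasLineDerivAt wdvvSigma
  have := HasDerivAt.fun_sum (u := Finset.univ.erase (0 : Fin (n+2))) fun k _ =>
    (ld_coord (x := x) a k).pow 2
  refine HasDerivAt.congr_deriv this ?_
  by_cases h : a = 0 <;> simp [h]

lemma ld_S (hx : x ∈ wdvvU n) :
    HasLineDerivAt ℝ wdvvS (if a = 0 then 0 else - x a / wdvvS x) x (Pi.single a 1) := by
  have h := (ld_sigma (x := x) a).const_sub 4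
  have := h.sqrt (by simpa using (by linarith [hx.2] : (4:ℝ) - wdvvSigma x ≠ 0))
  unfold HasLineDerivAt
  refine this.congr_deriv ?_
  have hs := wdvvS_pos hx
  simp only [zero_smul, add_zero, wdvvS] at *
  split_ifs <;> field_simp <;> simp

lemma ld_L (hx : x ∈ wdvvU n) :
    HasLineDerivAt ℝ wdvvL (if a = 0 then 0 else x a / (2 + wdvvS x)) x (Pi.single a 1) := by
  have hs := wdvvS_pos hx
  have h := ld_S a hx
  have := h.neg.add (((h.const_add 2).log (by simp; positivity)).const_mul 2)
  refine HasDerivAt.congr_deriv this ?_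
  simp only [zero_smul, add_zero] at *
  split_ifs
  · simp
  · field_simp; ring

lemma ld_logk (hx : x ∈ wdvvU n) (k : Fin (n + 2)) (hk : k ≠ 0) :
    HasLineDerivAt ℝ (fun x : Fin (n + 2) → ℝ => Real.log (x k)) (if a = k then 1 / x k else 0) x
      (Pi.single a 1) := by
  have := (ld_coord (x := x) a k).log (by simpa using (hx.1 k hk).ne')
  refine HasDerivAt.congr_deriv this ?_
  simp [ite_div]

lemma ld_sumlog (hx : x ∈ wdvvU n) :
    HasLineDerivAt ℝ (fun x : Fin (n + 2) → ℝ =>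
      ∑ k ∈ Finset.univ.erase 0, (x k) ^ 2 * Real.log (x k))
      (if a = 0 then 0 else 2 * x a * Real.log (x a) + x a) x (Pi.single a 1) := by
  have := HasDerivAt.fun_sum (u := Finset.univ.erase (0 : Fin (n+2))) fun k hk =>
    ((ld_coord (x := x) a k).pow 2).mul (ld_logk a hx k (Finset.ne_of_mem_erase hk))
  refine HasDerivAt.congr_deriv this ?_
  by_cases h : a = 0
  · simp only [h, if_true]
    apply Finset.sum_eq_zero
    intro k hk
    simp [(Finset.ne_of_mem_erase hk).symm]
  · have := hx.1 a h
    simp only [h, if_false]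
    rw [Finset.sum_eq_single a]
    · simp; field_simp
    · intro b _ hb
      simp [hb.symm]
    · simp [h]

noncomputable def wdvvD1 (c : Fin (n + 2)) (x : Fin (n + 2) → ℝ) : ℝ :=
  if c = 0 then x 0 ^ 2 / 2 + wdvvSigma x / 2 else x c * (x 0 - 2 * Real.log (x c) + wdvvL x)

noncomputable def wdvvD2 (b c : Fin (n + 2)) (x : Fin (n + 2) → ℝ) : ℝ :=
  if c = 0 then x b else if b = 0 then x c else
    (if b = c then 1 else 0) * (x 0 - 2 * Real.log (x c) + wdvvL x - 2)
      + x b * x c / (2 + wdvvS x)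

noncomputable def wdvvD3 (a b c : Fin (n + 2)) (x : Fin (n + 2) → ℝ) : ℝ :=
  if c = 0 then (if a = b then 1 else 0) else if b = 0 then (if a = c then 1 else 0) else
  if a = 0 then (if b = c then 1 else 0) else
    (if b = c then 1 else 0) * (- 2 * (if a = c then 1 / x c else 0) + x a / (2 + wdvvS x))
      + ((if a = b then 1 else 0) * x c + (if a = c then 1 else 0) * x b) / (2 + wdvvS x)
      + x a * x b * x c / (wdvvS x * (2 + wdvvS x) ^ 2)

lemma ld1 (hx : x ∈ wdvvU n) :
    HasLineDerivAt ℝ wdvvF (wdvvD1 a x) x (Pi.single a 1) := by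
  have hs := wdvvS_pos hx
  have hq := wdvvS_sq hx
  have h0 := ld_coord (x := x) a 0
  have h1 := ld_sigma (x := x) a
  have h2 := ld_S a hx
  have h3 := (h2.const_add 2).log (by simp; positivity)
  have h4 := ld_sumlog a hx
  have := (((((h0.pow 3).div_const 6).add ((h0.const_mul (1/2)).mul h1)).sub h4).sub
    (((h1.const_add 2).const_mul (1/3)).mul h2)).add (h1.mul h3)
  refine HasDerivAt.congr_deriv this ?_
  have e : wdvvSigma x = 4 - wdvvS x ^ 2 := by linarith
  simp only [zero_smul, add_zero, wdvvD1, wdvvL, e]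
  split_ifs
  · subst_vars; simp; ring
  · field_simp; ring

lemma ld2 (hx : x ∈ wdvvU n) (c : Fin (n + 2)) :
    HasLineDerivAt ℝ (wdvvD1 c) (wdvvD2 a c x) x (Pi.single a 1) := by
  have hs := wdvvS_pos hx
  have h0 := ld_coord (x := x) a 0
  by_cases hc : c = 0
  · have := ((h0.pow 2).div_const 2).add ((ld_sigma (x := x) a).div_const 2)
    unfold HasLineDerivAt
    simp only [wdvvD1, wdvvD2, hc, if_true]
    refine HasDerivAt.congr_deriv this ?_
    simp only [zero_smul, add_zero]
    split_ifs <;> simp [*]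
  · have h5 := ld_logk a hx c hc
    have h6 := ld_coord (x := x) a c
    have := h6.mul ((h0.sub (h5.const_mul 2)).add (ld_L a hx))
    unfold HasLineDerivAt
    simp only [wdvvD1, wdvvD2, hc, if_false]
    refine HasDerivAt.congr_deriv this ?_
    have hp := hx.1 c hc
    simp only [zero_smul, add_zero, Pi.add_apply, Pi.sub_apply]
    by_cases ha : a = 0
    · simp [ha, Ne.symm hc]
    · by_cases hac : a = c
      · subst hac; simp [ha]; field_simp; ring
      · simp [ha, hac]; ring

lemma ld3 (hx : x ∈ wdvvU n) (b c : Fin (n + 2)) :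
    HasLineDerivAt ℝ (wdvvD2 b c) (wdvvD3 a b c x) x (Pi.single a 1) := by
  have hs := wdvvS_pos hx
  have h0 := ld_coord (x := x) a 0
  by_cases hc : c = 0
  · unfold HasLineDerivAt
    simp only [wdvvD2, wdvvD3, hc, if_true]
    exact ld_coord a b
  by_cases hb : b = 0
  · unfold HasLineDerivAt
    simp only [wdvvD2, wdvvD3, hc, hb, if_true, if_false]
    exact ld_coord a c
  have h5 := ld_logk a hx c hc
  have h6 := ld_coord (x := x) a c
  have h7 := ld_coord (x := x) a b
  have := ((((h0.sub (h5.const_mul 2)).add (ld_L a hx)).sub_const 2).const_mul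
    (if b = c then 1 else 0)).add ((h7.mul h6).div ((ld_S a hx).const_add 2)
      (by simp; positivity))
  unfold HasLineDerivAt
  simp only [wdvvD2, wdvvD3, hc, hb, if_false]
  refine HasDerivAt.congr_deriv this ?_
  have hp := hx.1 c hc
  simp only [zero_smul, add_zero, Pi.mul_apply]
  by_cases ha : a = 0
  · simp [ha, Ne.symm hc, Ne.symm hb]
  · simp only [ha, if_false]
    split_ifs <;> field_simp <;> ring

end

lemma wdvvF3_eq {n : ℕ} {v : Fin (n + 2) → ℝ} (hv : v ∈ wdvvU n) (a b c : Fin (n + 2)) :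
    wdvvF3 v a b c = wdvvD3 a b c v := by
  have hU : ∀ {x : Fin (n + 2) → ℝ}, x ∈ wdvvU n → ∀ᶠ y in nhds x, y ∈ wdvvU n :=
    fun hx => wdvvU_open.mem_nhds hx
  refine iter_step (g := wdvvD2 b c) (wdvvF_contDiffAt hv) _ _ ?_ (ld3 a hv b c)
  filter_upwards [hU hv] with x hx
  refine iter_step (g := wdvvD1 c) ((wdvvF_contDiffAt hx).of_le (by norm_num)) _ _ ?_ (ld2 b hx c)
  filter_upwards [hU hx] with y hy
  refine iter_step (g := wdvvF) ((wdvvF_contDiffAt hy).of_le (by norm_num)) _ _ ?_ (ld1 c hy)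
  exact Filter.Eventually.of_forall fun z => by simp


/-- Contraction of the structure constants with an arbitrary vector. -/
lemma wdvv_contract {n : ℕ} (v : Fin (n + 2) → ℝ) (g : Fin (n + 2) → ℝ)
    {a b : Fin (n + 2)} (ha : a ≠ 0) (hb : b ≠ 0) :
    ∑ m ∈ Finset.univ.erase 0, wdvvD3 a b m v * g m =
      (if a = b then 1 else 0) * (-2 / v a * g a
        + (∑ m ∈ Finset.univ.erase 0, v m * g m) / (2 + wdvvS v))
      + (v b * g a + v a * g b) / (2 + wdvvS v)
      + v a * v b / (wdvvS v * (2 + wdvvS v) ^ 2) * ∑ m ∈ Finset.univ.erase 0, v m * g m := by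
  have key : ∀ m ∈ Finset.univ.erase (0 : Fin (n + 2)), wdvvD3 a b m v * g m =
      (if m = a then (if a = b then 1 else 0) * (-2 / v a) * g a + v b * g a / (2 + wdvvS v) else 0)
      + (if m = b then v a * g b / (2 + wdvvS v) else 0)
      + ((if a = b then 1 else 0) / (2 + wdvvS v)
        + v a * v b / (wdvvS v * (2 + wdvvS v) ^ 2)) * (v m * g m) := by
    intro m hm
    have hm0 := Finset.ne_of_mem_erase hm
    simp only [wdvvD3, ha, hb, hm0, if_false]
    by_cases h1 : m = a
    · subst h1
      by_cases h2 : m = b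
      · subst h2; simp; ring
      · simp [h2, Ne.symm h2]; ring
    · by_cases h2 : m = b
      · subst h2; simp [h1, Ne.symm h1]; ring
      · simp only [h1, h2, Ne.symm h1, Ne.symm h2, if_false]; ring
  rw [Finset.sum_congr rfl key, Finset.sum_add_distrib, Finset.sum_add_distrib,
    Finset.sum_ite_eq', Finset.sum_ite_eq', ← Finset.mul_sum]
  simp only [Finset.mem_erase, ha, hb, Finset.mem_univ, ne_eq, not_false_eq_true, and_self, if_true]
  ring

lemma wdvvD3_swap13 {n : ℕ} (v : Fin (n + 2) → ℝ) (a b c : Fin (n + 2)) :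
    wdvvD3 a b c v = wdvvD3 c b a v := by
  unfold wdvvD3
  by_cases h1 : a = b <;> by_cases h2 : b = c <;> by_cases h3 : a = c <;>
    by_cases ha : a = 0 <;> by_cases hb : b = 0 <;> by_cases hc : c = 0 <;> grind

lemma wdvvD3_swap23 {n : ℕ} (v : Fin (n + 2) → ℝ) (a b c : Fin (n + 2)) :
    wdvvD3 a b c v = wdvvD3 a c b v := by
  unfold wdvvD3
  by_cases h1 : a = b <;> by_cases h2 : b = c <;> by_cases h3 : a = c <;>
    by_cases ha : a = 0 <;> by_cases hb : b = 0 <;> by_cases hc : c = 0 <;> grind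

lemma wdvv_trace {n : ℕ} {v : Fin (n + 2) → ℝ} (hv : v ∈ wdvvU n)
    {c d : Fin (n + 2)} (hc : c ≠ 0) (hd : d ≠ 0) :
    ∑ m ∈ Finset.univ.erase 0, v m * wdvvD3 m c d v =
      (if c = d then 1 else 0) * (- wdvvS v) + v c * v d / wdvvS v := by
  have h := wdvv_contract v v hd hc
  have e : ∑ m ∈ Finset.univ.erase 0, v m * v m = 4 - wdvvS v ^ 2 := by
    rw [wdvvS_sq hv, wdvvSigma]
    simp [pow_two]
  rw [e] at h
  have hs := wdvvS_pos hv
  have hcp := hv.1 c hc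
  have hdp := hv.1 d hd
  rw [Finset.sum_congr rfl (fun m _ => by rw [wdvvD3_swap13 v m c d, mul_comm]), h]
  by_cases hcd : c = d
  · subst hcd; simp; field_simp; ring
  · simp [hcd, Ne.symm hcd]; field_simp; ring

lemma wdvvD3_zero {n : ℕ} (v : Fin (n + 2) → ℝ) (a b : Fin (n + 2)) :
    wdvvD3 a b 0 v = if a = b then 1 else 0 := by simp [wdvvD3]

lemma wdvvD3_zero_left {n : ℕ} (v : Fin (n + 2) → ℝ) (a b : Fin (n + 2)) :
    wdvvD3 0 a b v = if a = b then 1 else 0 := by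
  rw [wdvvD3_swap13, wdvvD3_zero]; simp [eq_comm]

lemma wdvvD3_zero_mid {n : ℕ} (v : Fin (n + 2) → ℝ) (a b : Fin (n + 2)) :
    wdvvD3 a 0 b v = if a = b then 1 else 0 := by
  rw [wdvvD3_swap23, wdvvD3_zero]

lemma wdvv_prod {n : ℕ} {v : Fin (n + 2) → ℝ} (hv : v ∈ wdvvU n)
    {a b c d : Fin (n + 2)} (ha : a ≠ 0) (hb : b ≠ 0) (hc : c ≠ 0) (hd : d ≠ 0) :
    ∑ m, wdvvD3 a b m v * wdvvD3 m c d v =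
      (if a = b then 1 else 0) * (if c = d then 1 else 0) +
      ((if a = b then 1 else 0) * (-2 / v a * wdvvD3 a c d v
        + ((if c = d then 1 else 0) * (- wdvvS v) + v c * v d / wdvvS v) / (2 + wdvvS v))
      + (v b * wdvvD3 a c d v + v a * wdvvD3 b c d v) / (2 + wdvvS v)
      + v a * v b / (wdvvS v * (2 + wdvvS v) ^ 2) *
        ((if c = d then 1 else 0) * (- wdvvS v) + v c * v d / wdvvS v)) := by
  rw [← Finset.add_sum_erase _ _ (Finset.mem_univ (0 : Fin (n + 2))),
    wdvv_contract v (fun m => wdvvD3 m c d v) ha hb, wdvv_trace hv hc hd, wdvvD3_zero,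
    wdvvD3_zero_left]

lemma wdvv_assoc {n : ℕ} {v : Fin (n + 2) → ℝ} (hv : v ∈ wdvvU n)
    (a b c d : Fin (n + 2)) :
    ∑ m, wdvvD3 a b m v * wdvvD3 m c d v = ∑ m, wdvvD3 d b m v * wdvvD3 m c a v := by
  by_cases ha : a = 0
  · subst ha
    simp only [wdvvD3_zero, wdvvD3_zero_left, ite_mul, mul_ite, one_mul, mul_one, zero_mul, mul_zero]
    simp
    rw [wdvvD3_swap13, wdvvD3_swap23]
  by_cases hd : d = 0
  · subst hd
    simp only [wdvvD3_zero, wdvvD3_zero_left, ite_mul, mul_ite, one_mul, mul_one, zero_mul, mul_zero]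
    simp
    rw [wdvvD3_swap23, wdvvD3_swap13, wdvvD3_swap23, wdvvD3_swap13]
  by_cases hb : b = 0
  · subst hb
    simp only [wdvvD3_zero_mid, ite_mul, one_mul, zero_mul]
    simp
    rw [wdvvD3_swap13]
  by_cases hc : c = 0
  · subst hc
    simp only [wdvvD3_zero_mid, mul_ite, mul_one, mul_zero]
    simp
    rw [wdvvD3_swap13]
  rw [wdvv_prod hv ha hb hc hd, wdvv_prod hv hd hb hc ha]
  have hs := wdvvS_pos hv
  have hap := hv.1 a ha
  have hbp := hv.1 b hb
  have hcp := hv.1 c hc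
  have hdp := hv.1 d hd
  simp only [wdvvD3, ha, hb, hc, hd, if_false]
  generalize wdvvS v = s at *
  by_cases h1 : a = d
  · subst h1; rfl
  by_cases h2 : a = b
  · subst h2
    by_cases h3 : a = c
    · subst h3
      simp only [if_true, h1, Ne.symm h1, if_false]; field_simp; ring
    · by_cases h4 : c = d
      · subst h4
        simp only [if_true, h1, Ne.symm h1, if_false]; field_simp; ring
      · simp only [if_true, h1, h3, h4, Ne.symm h1, Ne.symm h3, Ne.symm h4, if_false]
        field_simp; ring
  by_cases h3 : a = c
  · subst h3
    by_cases h4 : b = d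
    · subst h4
      simp only [if_true, h1, Ne.symm h1, if_false]; field_simp; ring
    · simp only [if_true, h1, h2, h4, Ne.symm h1, Ne.symm h2, Ne.symm h4, if_false]
      field_simp; ring
  by_cases h4 : b = d
  · subst h4
    by_cases h5 : b = c
    · subst h5
      simp only [if_true, h1, Ne.symm h1, if_false]; field_simp; ring
    · simp only [if_true, h1, h3, h5, Ne.symm h1, Ne.symm h3, Ne.symm h5, if_false]
      field_simp; ring
  by_cases h5 : b = c
  · subst h5
    simp only [if_true, h1, h2, h4, Ne.symm h1, Ne.symm h2, Ne.symm h4, if_false]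
    field_simp; ring
  by_cases h6 : c = d
  · subst h6
    simp only [if_true, h1, h2, h5, Ne.symm h1, Ne.symm h2, Ne.symm h5, if_false]
    field_simp; ring
  simp only [h1, h2, h3, h4, h5, h6, Ne.symm h1, Ne.symm h2, Ne.symm h3, Ne.symm h4, Ne.symm h5,
    Ne.symm h6, if_false]
  field_simp; ring

/-- On the domain where `v_k > 0` for `k ≥ 2` and
`σ(v) = ∑_{k≥2} v_k² < 4`, the potential `F` satisfies the normalization
`∂³F/∂v_α∂v_β∂v¹ = δ_αβ` and the WDVV associativity equations with `η = 1`: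
`∑_λ F_{αβλ} F_{λγδ} = ∑_λ F_{δβλ} F_{λγα}` for all `α, β, γ, δ`. -/
theorem stmt19 {n : ℕ} (v : Fin (n + 2) → ℝ)
    (hv : ∀ k : Fin (n + 2), k ≠ 0 → 0 < v k)
    (hσ : wdvvSigma v < 4) :
    (∀ α β : Fin (n + 2), wdvvF3 v α β 0 = if α = β then 1 else 0) ∧
    (∀ α β γ δ : Fin (n + 2),
      ∑ lam, wdvvF3 v α β lam * wdvvF3 v lam γ δ
        = ∑ lam, wdvvF3 v δ β lam * wdvvF3 v lam γ α) := by
  have hU : v ∈ wdvvU n := ⟨hv, hσ⟩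
  simp only [wdvvF3_eq hU]
  exact ⟨fun α β => wdvvD3_zero v α β, fun α β γ δ => wdvv_assoc hU α β γ δ⟩
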